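/- arXiv:1212.4713 — 4 statements merged into one kernel-verified Lean document; each statement's English description precedes it below -/
import Mathlib

section
/- Let p be a prime number. For every τ in the complex upper half-plane ℍ, one has g(−1/τ) · g(τ/p) = p¹², where g is defined from the absolutely convergent product below. Equivalently, g(−1/τ) = p¹² · g(τ/p)⁻¹ (the value g(τ/p) is nonzero). -/
/-- `q_τ = exp(2πiτ)`. -/
noncomputable def qt (τ : ℂ) : ℂ := Complex.exp (2 * Real.pi * Complex.I * τ)

/-- `g(τ) = exp(2πi(1−p)τ) · ∏_{n ≥ 1, p ∤ n} (1 − q_τⁿ)²⁴`. -/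
noncomputable def modg (p : ℕ) (τ : ℂ) : ℂ :=
  Complex.exp (2 * Real.pi * Complex.I * ((1 : ℂ) - (p : ℂ)) * τ) *
    ∏' n : {n : ℕ // 0 < n ∧ ¬ p ∣ n}, (1 - qt τ ^ (n : ℕ)) ^ 24

lemma aux_norm_qt {τ : ℂ} (hτ : 0 < τ.im) : ‖qt τ‖ < 1 := by
  simpa [qt] using UpperHalfPlane.norm_exp_two_pi_I_lt_one ⟨τ, hτ⟩

/-- Splitting of the full product into multiples and non-multiples of `p`. -/
lemma aux_split (p : ℕ) (hp : p.Prime) (q : ℂ) (hq : ‖q‖ < 1) :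
    (∏' n : {n : ℕ // 0 < n ∧ ¬ p ∣ n}, (1 - q ^ (n : ℕ)) ^ 24) *
      (∏' n : ℕ, (1 - (q ^ p) ^ (n + 1)) ^ 24) = ∏' n : ℕ, (1 - q ^ (n + 1)) ^ 24 := by
  have hqp : ‖q ^ p‖ < 1 := by
    rw [norm_pow]
    exact pow_lt_one₀ (norm_nonneg _) hq hp.ne_zero
  let S : Set ℕ := {n | ¬ p ∣ n + 1}
  let f : ℕ → ℂ := fun n ↦ (1 - q ^ (n + 1)) ^ 24
  let e1 : S ≃ {n : ℕ // 0 < n ∧ ¬ p ∣ n} :=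
    { toFun := fun n ↦ ⟨n.1 + 1, Nat.succ_pos _, n.2⟩
      invFun := fun n ↦ ⟨n.1 - 1, by
        have h := n.2
        change ¬ p ∣ n.1 - 1 + 1
        rw [Nat.sub_add_cancel h.1]
        exact h.2⟩
      left_inv := fun n ↦ by simp
      right_inv := fun n ↦ by
        have h := n.2.1
        apply Subtype.ext
        simp only
        omega }
  have hmem : ∀ n : ℕ, p * (n + 1) - 1 + 1 = p * (n + 1) := fun n ↦
    Nat.sub_add_cancel (Nat.mul_pos hp.pos n.succ_pos)
  let g : ℕ → (Sᶜ : Set ℕ) := fun n ↦ ⟨p * (n + 1) - 1, by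
    change ¬ ¬ p ∣ p * (n + 1) - 1 + 1
    rw [hmem, not_not]
    exact dvd_mul_right _ _⟩
  have hg : Function.Bijective g := by
    constructor
    · intro a b hab
      have h1 : p * (a + 1) - 1 = p * (b + 1) - 1 := congrArg Subtype.val hab
      have h2 : p * (a + 1) = p * (b + 1) := by rw [← hmem a, ← hmem b, h1]
      have := Nat.eq_of_mul_eq_mul_left hp.pos h2
      omega
    · rintro ⟨n, hn⟩
      have hn' : p ∣ n + 1 := not_not.mp hn
      obtain ⟨k, hk⟩ := hn'
      have hk0 : k ≠ 0 := by rintro rfl; simp at hk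
      refine ⟨k - 1, Subtype.ext ?_⟩
      change p * (k - 1 + 1) - 1 = n
      rw [Nat.sub_add_cancel (Nat.pos_of_ne_zero hk0), ← hk]
      simp
  have hsum : Summable fun n : ℕ ↦ ‖-q ^ (n + 1)‖ := by
    simpa using (summable_nat_add_iff 1).mpr (summable_geometric_of_lt_one (norm_nonneg _) hq)
  have m1 : Multipliable (f ∘ ((↑) : S → ℕ)) := by
    have : Multipliable fun n : S ↦ (1 + -q ^ ((n : ℕ) + 1)) :=
      multipliable_one_add_of_summable (hsum.subtype S)
    simpa [f, Function.comp_def, sub_eq_add_neg] using this.pow 24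
  have m2 : Multipliable (f ∘ ((↑) : (Sᶜ : Set ℕ) → ℕ)) := by
    have : Multipliable fun n : (Sᶜ : Set ℕ) ↦ (1 + -q ^ ((n : ℕ) + 1)) :=
      multipliable_one_add_of_summable (hsum.subtype Sᶜ)
    simpa [f, Function.comp_def, sub_eq_add_neg] using this.pow 24
  have key := (m1.hasProd.mul_compl m2.hasProd).tprod_eq
  have k1 : ∏' n : {n : ℕ // 0 < n ∧ ¬ p ∣ n}, (1 - q ^ (n : ℕ)) ^ 24 =
      ∏' n : S, (f ∘ ((↑) : S → ℕ)) n :=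
    (e1.tprod_eq (fun n : {n : ℕ // 0 < n ∧ ¬ p ∣ n} ↦ (1 - q ^ (n : ℕ)) ^ 24)).symm
  have k2 : ∏' n : ℕ, (1 - (q ^ p) ^ (n + 1)) ^ 24 =
      ∏' n : (Sᶜ : Set ℕ), (f ∘ ((↑) : (Sᶜ : Set ℕ) → ℕ)) n := by
    rw [← (Equiv.ofBijective g hg).tprod_eq]
    refine tprod_congr fun n ↦ ?_
    change _ = (1 - q ^ (p * (n + 1) - 1 + 1)) ^ 24
    rw [hmem, pow_mul]
  rw [k1, k2, ← key]

lemma aux_eta (τ : ℂ) (hτ : 0 < τ.im) :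
    ModularForm.eta τ ^ 24 = qt τ * ∏' n : ℕ, (1 - qt τ ^ (n + 1)) ^ 24 := by
  have hq : Function.Periodic.qParam 1 τ = qt τ := by
    simp [Function.Periodic.qParam, qt]
  have h24 : Function.Periodic.qParam 24 τ ^ 24 = qt τ := by
    rw [Function.Periodic.qParam, qt, ← Complex.exp_nat_mul]
    congr 1
    push_cast
    ring
  rw [ModularForm.eta, mul_pow, h24]
  simp only [ModularForm.eta_q, hq]
  rw [(ModularForm.multipliable_one_sub_pow (aux_norm_qt hτ)).tprod_pow 24]

lemma aux_modg (p : ℕ) (hp : p.Prime) (τ : ℂ) (hτ : 0 < τ.im) :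
    modg p τ * ModularForm.eta (p * τ) ^ 24 = ModularForm.eta τ ^ 24 := by
  have hp0 : (0 : ℝ) < p := by exact_mod_cast hp.pos
  have hpτ : 0 < ((p : ℂ) * τ).im := by simpa using mul_pos hp0 hτ
  have hq : qt (p * τ) = qt τ ^ p := by
    rw [qt, qt, ← Complex.exp_nat_mul]
    congr 1
    ring
  have he : Complex.exp (2 * Real.pi * Complex.I * ((1 : ℂ) - (p : ℂ)) * τ) * qt (p * τ)
      = qt τ := by
    rw [qt, qt, ← Complex.exp_add]
    congr 1
    ring
  rw [aux_eta τ hτ, aux_eta _ hpτ, ← aux_split p hp (qt τ) (aux_norm_qt hτ), modg, ← hq]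
  linear_combination (∏' n : {n : ℕ // 0 < n ∧ ¬ p ∣ n}, (1 - qt τ ^ (n : ℕ)) ^ 24) *
    (∏' n : ℕ, (1 - (qt (p * τ)) ^ (n + 1)) ^ 24) * he

lemma aux_S (τ : ℂ) (hτ : 0 < τ.im) :
    ModularForm.eta (-1 / τ) ^ 24 = τ ^ 12 * ModularForm.eta τ ^ 24 := by
  have h0 : τ ≠ 0 := by rintro rfl; simp at hτ
  have hs : ∀ z : ℂ, z ≠ 0 → Complex.sqrt z ^ 24 = z ^ 12 := by
    intro z hz
    rw [sqrt_eq_exp hz, ← Complex.exp_nat_mul,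
      show ((24 : ℕ) : ℂ) * (Complex.log z / 2) = (12 : ℕ) * Complex.log z by push_cast; ring,
      Complex.exp_nat_mul, Complex.exp_log hz]
  have he : ModularForm.eta (-1 / τ) =
      (Complex.sqrt Complex.I)⁻¹ * (Complex.sqrt τ * ModularForm.eta τ) :=
    ModularForm.eta_comp_eq_csqrt_I_inv hτ
  have hI : Complex.I ^ 12 = 1 := by
    rw [show 12 = 4 * 3 by norm_num, pow_mul, Complex.I_pow_four, one_pow]
  rw [he, mul_pow, mul_pow, inv_pow, hs _ Complex.I_ne_zero, hs _ h0, hI, inv_one, one_mul]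

theorem stmt_2 (p : ℕ) (hp : p.Prime) (τ : ℂ) (hτ : 0 < τ.im) :
    modg p (τ / p) ≠ 0 ∧ modg p (-1 / τ) * modg p (τ / p) = (p : ℂ) ^ 12 := by
  have h0 : τ ≠ 0 := by rintro rfl; simp at hτ
  have hp0 : (p : ℂ) ≠ 0 := by exact_mod_cast hp.ne_zero
  have hpR : (0 : ℝ) < p := by exact_mod_cast hp.pos
  have hτp : 0 < (τ / p).im := by
    rw [Complex.div_natCast_im]
    exact div_pos hτ hpR
  have hS : 0 < (-1 / τ).im := by
    have := UpperHalfPlane.im_inv_neg_coe_pos ⟨τ, hτ⟩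
    rw [show -1 / τ = (-τ)⁻¹ by rw [inv_neg]; ring]
    exact this
  have e1 := aux_modg p hp (τ / p) hτp
  rw [mul_div_cancel₀ _ hp0] at e1
  have e2 := aux_modg p hp (-1 / τ) hS
  rw [show (p : ℂ) * (-1 / τ) = -1 / (τ / p) by field_simp, aux_S τ hτ, aux_S _ hτp] at e2
  have n1 : ModularForm.eta τ ^ 24 ≠ 0 := pow_ne_zero _ (ModularForm.eta_ne_zero hτ)
  have n2 : ModularForm.eta (τ / p) ^ 24 ≠ 0 := pow_ne_zero _ (ModularForm.eta_ne_zero hτp)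
  refine ⟨fun h ↦ n2 (by rw [← e1, h, zero_mul]), ?_⟩
  rw [← e1, div_pow] at e2
  have hτ12 : τ ^ 12 ≠ 0 := pow_ne_zero _ h0
  have hp12 : (p : ℂ) ^ 12 ≠ 0 := pow_ne_zero _ hp0
  apply mul_right_cancel₀ n1
  apply mul_right_cancel₀ hτ12
  have e3 : modg p (-1 / τ) * (τ ^ 12 / (p : ℂ) ^ 12 * (modg p (τ / p) * ModularForm.eta τ ^ 24))
      * (p : ℂ) ^ 12 = τ ^ 12 * ModularForm.eta τ ^ 24 * (p : ℂ) ^ 12 := by rw [e2]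
  rw [show modg p (-1 / τ) * (τ ^ 12 / (p : ℂ) ^ 12 * (modg p (τ / p) * ModularForm.eta τ ^ 24))
      * (p : ℂ) ^ 12 = modg p (-1 / τ) * modg p (τ / p) * ModularForm.eta τ ^ 24 * τ ^ 12 *
        ((p : ℂ) ^ 12 / (p : ℂ) ^ 12) by ring, div_self hp12] at e3
  linear_combination e3
end

section
/- For every integer F ≥ 1 and every integer K, one has ∑_{γ=1}^{F−1} |sin(πγK/F)| / sin(πγ/F) ≤ (4F/π²) · (log F + 1.5). -/
open Finset in
/-- Periodicity: sin squared of `π n / F` depends only on `n mod F`. -/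
theorem aux_sin_sq_emod (F : ℕ) (hF : 1 ≤ F) (n g : ℤ) :
    Real.sin (Real.pi * g * n / F) ^ 2 = Real.sin (Real.pi * g * ((n % (F : ℤ) : ℤ) : ℝ) / F) ^ 2 := by
  have hF0 : (F : ℝ) ≠ 0 := by positivity
  have h : (n : ℝ) = ((n % (F : ℤ) : ℤ) : ℝ) + F * ((n / (F : ℤ) : ℤ) : ℝ) := by
    exact_mod_cast (Int.emod_add_mul_ediv n F).symm
  have h2 : Real.pi * g * n / F = Real.pi * g * ((n % (F : ℤ) : ℤ) : ℝ) / F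
      + ((g * (n / (F : ℤ)) : ℤ) : ℝ) * Real.pi := by
    rw [h]; push_cast
    field_simp
  rw [h2, Real.sin_add_int_mul_pi]
  rcases Int.even_or_odd (g * (n / (F : ℤ))) with h | h
  · simp [h.neg_one_zpow]
  · simp [h.neg_one_zpow]

/-- angle -/
noncomputable def auxPhi (F m : ℕ) : ℝ := Real.pi * (2 * m + 1) / (2 * F)

/-- cotangent of the angle -/
noncomputable def auxC (F m : ℕ) : ℝ := Real.cos (auxPhi F m) / Real.sin (auxPhi F m)

theorem auxPhi_pos (F m : ℕ) (hF : 1 ≤ F) : 0 < auxPhi F m := by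
  have := Real.pi_pos
  unfold auxPhi; positivity

theorem auxPhi_lt (F m : ℕ) (hm : m < F) : auxPhi F m < Real.pi := by
  have := Real.pi_pos
  have hF : (0 : ℝ) < F := by exact_mod_cast (by omega : 0 < F)
  unfold auxPhi
  rw [div_lt_iff₀ (by positivity)]
  have : (m : ℝ) + 1 ≤ F := by exact_mod_cast hm
  nlinarith

theorem auxSin_pos (F m : ℕ) (hm : m < F) : 0 < Real.sin (auxPhi F m) :=
  Real.sin_pos_of_pos_of_lt_pi (auxPhi_pos F m (by omega)) (auxPhi_lt F m hm)

theorem aux_sin_pos (F t : ℕ) (h1 : 1 ≤ t) (h2 : t < F) : 0 < Real.sin (Real.pi * t / F) := by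
  have := Real.pi_pos
  have ht : (0 : ℝ) < t := by exact_mod_cast h1
  have hF : (0 : ℝ) < F := by exact_mod_cast (by omega : 0 < F)
  have h3 : (t : ℝ) < F := by exact_mod_cast h2
  apply Real.sin_pos_of_pos_of_lt_pi
  · positivity
  · rw [div_lt_iff₀ hF]; nlinarith

theorem aux_L1 (F t : ℕ) (h1 : 1 ≤ t) (h2 : t < F) :
    ∑ m ∈ Finset.range F, Real.cos (2 * t * auxPhi F m) = 0 := by
  have hs := aux_sin_pos F t h1 h2
  have hF : (F : ℝ) ≠ 0 := by exact_mod_cast (by omega : F ≠ 0)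
  have key : 2 * Real.sin (Real.pi * t / F) *
      ∑ m ∈ Finset.range F, Real.cos (2 * t * auxPhi F m) = 0 := by
    rw [Finset.mul_sum]
    have : ∀ m ∈ Finset.range F, 2 * Real.sin (Real.pi * t / F) * Real.cos (2 * t * auxPhi F m)
        = Real.sin (2 * Real.pi * t * ((m + 1 : ℕ) : ℝ) / F) - Real.sin (2 * Real.pi * t * (m : ℝ) / F) := by
      intro m _
      have e1 : 2 * Real.pi * t * ((m + 1 : ℕ) : ℝ) / F = 2 * t * auxPhi F m + Real.pi * t / F := by
        unfold auxPhi; push_cast; field_simp; ring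
      have e2 : 2 * Real.pi * t * (m : ℝ) / F = 2 * t * auxPhi F m - Real.pi * t / F := by
        unfold auxPhi; field_simp; ring
      rw [e1, e2, Real.sin_add, Real.sin_sub]; ring
    rw [Finset.sum_congr rfl this,
      Finset.sum_range_sub (fun m : ℕ => Real.sin (2 * Real.pi * t * (m : ℝ) / F))]
    have : 2 * Real.pi * t * (F : ℝ) / F = ((2 * t : ℕ) : ℝ) * Real.pi := by
      push_cast; field_simp
    rw [this, Real.sin_nat_mul_pi]; simp
  rcases mul_eq_zero.mp key with h | h
  · linarith
  · exact h

theorem aux_L2 (F t : ℕ) (h2 : t + 1 < F) :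
    ∑ m ∈ Finset.range F, auxC F m * Real.sin (2 * (t + 1 : ℕ) * auxPhi F m) = F := by
  have step : ∀ t : ℕ, ∑ m ∈ Finset.range F, auxC F m * Real.sin (2 * (t + 1 : ℕ) * auxPhi F m)
      = ∑ m ∈ Finset.range F, auxC F m * Real.sin (2 * (t : ℕ) * auxPhi F m)
        + ∑ m ∈ Finset.range F, Real.cos (2 * (t + 1 : ℕ) * auxPhi F m)
        + ∑ m ∈ Finset.range F, Real.cos (2 * (t : ℕ) * auxPhi F m) := by
    intro t
    rw [← Finset.sum_add_distrib, ← Finset.sum_add_distrib]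
    apply Finset.sum_congr rfl
    intro m hm
    have hs := auxSin_pos F m (Finset.mem_range.mp hm)
    unfold auxC
    have e1 : 2 * ((t + 1 : ℕ) : ℝ) * auxPhi F m = (2 * t + 1) * auxPhi F m + auxPhi F m := by
      push_cast; ring
    have e2 : 2 * (t : ℝ) * auxPhi F m = (2 * t + 1) * auxPhi F m - auxPhi F m := by ring
    rw [e1, e2, Real.sin_add, Real.sin_sub, Real.cos_add, Real.cos_sub]
    field_simp
    ring
  induction t with
  | zero =>
    rw [step, aux_L1 F (0+1) (by omega) h2]; simp
  | succ t ih =>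
    rw [step, ih (by omega), aux_L1 F (t+1) (by omega) (by omega), aux_L1 F (t+1+1) (by omega) (by omega)]
    simp

/-- the discrete Fourier expansion of `sin` -/
theorem aux_L3 (F t : ℕ) (h2 : t < F) :
    (F : ℝ) * Real.sin (Real.pi * t / F) = ∑ m ∈ Finset.range (F - 1),
      (auxC F m - auxC F (m + 1)) * Real.sin (Real.pi * (m + 1 : ℕ) * t / F) ^ 2 := by
  have hF : (F : ℝ) ≠ 0 := by exact_mod_cast (by omega : F ≠ 0)
  rcases t with _ | t
  · simp
  have abel : ∀ n : ℕ, ∑ m ∈ Finset.range n,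
      (auxC F m - auxC F (m + 1)) * Real.sin (Real.pi * (m + 1 : ℕ) * (t + 1 : ℕ) / F) ^ 2
      = ∑ m ∈ Finset.range n, auxC F m * (Real.sin (Real.pi * (m + 1 : ℕ) * (t + 1 : ℕ) / F) ^ 2
        - Real.sin (Real.pi * (m : ℕ) * (t + 1 : ℕ) / F) ^ 2)
        - auxC F n * Real.sin (Real.pi * (n : ℕ) * (t + 1 : ℕ) / F) ^ 2 := by
    intro n
    induction n with
    | zero => simp
    | succ n ih => rw [Finset.sum_range_succ, ih, Finset.sum_range_succ]; ring
  have h3 : ∑ m ∈ Finset.range F, auxC F m * (Real.sin (Real.pi * (m + 1 : ℕ) * (t + 1 : ℕ) / F) ^ 2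
        - Real.sin (Real.pi * (m : ℕ) * (t + 1 : ℕ) / F) ^ 2)
      = (F : ℝ) * Real.sin (Real.pi * (t + 1 : ℕ) / F) := by
    nth_rewrite 3 [← aux_L2 F t h2]
    rw [Finset.sum_mul]
    apply Finset.sum_congr rfl
    intro m _
    set a := Real.pi * (m : ℕ) * (t + 1 : ℕ) / F with ha
    set b := Real.pi * (t + 1 : ℕ) / F with hb
    have e1 : Real.pi * (m + 1 : ℕ) * (t + 1 : ℕ) / F = a + b := by
      rw [ha, hb]; push_cast; field_simp
    have e2 : 2 * ((t + 1 : ℕ) : ℝ) * auxPhi F m = a + (a + b) := by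
      rw [ha, hb]; unfold auxPhi; push_cast; field_simp; ring
    rw [e1, e2, Real.sin_add a (a+b), Real.sin_add a b, Real.cos_add a b]
    have := Real.sin_sq_add_cos_sq a
    have := Real.sin_sq_add_cos_sq b
    have hca : Real.cos a ^ 2 = 1 - Real.sin a ^ 2 := by linarith
    have hcb : Real.cos b ^ 2 = 1 - Real.sin b ^ 2 := by linarith
    ring_nf
    simp only [hca, hcb]
    ring
  obtain ⟨G, rfl⟩ : ∃ G, F = G + 1 := ⟨F - 1, by omega⟩
  rw [← h3, Nat.add_sub_cancel, abel, Finset.sum_range_succ]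
  have : Real.pi * ((G + 1 : ℕ) : ℝ) * (t + 1 : ℕ) / (G + 1 : ℕ) = ((t + 1 : ℕ) : ℝ) * Real.pi := by
    field_simp
  rw [this, Real.sin_nat_mul_pi]
  ring

theorem aux_L3' (F : ℕ) (hF : 1 ≤ F) (n : ℤ) :
    (F : ℝ) * |Real.sin (Real.pi * n / F)| = ∑ m ∈ Finset.range (F - 1),
      (auxC F m - auxC F (m + 1)) * Real.sin (Real.pi * (m + 1 : ℕ) * n / F) ^ 2 := by
  have hpos : (0 : ℤ) < F := by exact_mod_cast hF
  obtain ⟨t, ht⟩ := Int.eq_ofNat_of_zero_le (Int.emod_nonneg n hpos.ne')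
  have hlt : t < F := by have := Int.emod_lt_of_pos n hpos; omega
  have h0 : 0 ≤ Real.sin (Real.pi * t / F) := by
    rcases Nat.eq_zero_or_pos t with h | h
    · simp [h]
    · exact (aux_sin_pos F t h hlt).le
  have h1 : |Real.sin (Real.pi * n / F)| = Real.sin (Real.pi * t / F) := by
    rw [← abs_of_nonneg h0, ← sq_eq_sq_iff_abs_eq_abs]
    have := aux_sin_sq_emod F hF n 1
    rw [ht] at this
    simpa using this
  rw [h1, aux_L3 F t hlt]
  apply Finset.sum_congr rfl
  intro m _
  have := aux_sin_sq_emod F hF n ((m + 1 : ℕ) : ℤ)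
  rw [ht] at this
  simp only [Int.cast_natCast] at this
  rw [this]

theorem aux_L4a (F j : ℕ) (hj : j < F) :
    ∑ g ∈ Finset.Icc 1 (F - 1), Real.sin (2 * g * auxPhi F j) = auxC F j := by
  have hs := auxSin_pos F j hj
  have hF : (F : ℝ) ≠ 0 := by exact_mod_cast (by omega : F ≠ 0)
  obtain ⟨G, rfl⟩ : ∃ G, F = G + 1 := ⟨F - 1, by omega⟩
  rw [Nat.add_sub_cancel]
  have tel : ∀ n : ℕ, 2 * Real.sin (auxPhi (G+1) j) * ∑ g ∈ Finset.Icc 1 n, Real.sin (2 * g * auxPhi (G+1) j)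
      = Real.cos (auxPhi (G+1) j) - Real.cos ((2 * n + 1) * auxPhi (G+1) j) := by
    intro n
    induction n with
    | zero => simp
    | succ n ih =>
      rw [Finset.sum_Icc_succ_top (by omega), mul_add, ih]
      have e1 : (2 * (n : ℝ) + 1) * auxPhi (G+1) j = 2 * ((n + 1 : ℕ) : ℝ) * auxPhi (G+1) j - auxPhi (G+1) j := by
        push_cast; ring
      have e2 : (2 * ((n + 1 : ℕ) : ℝ) + 1) * auxPhi (G+1) j = 2 * ((n + 1 : ℕ) : ℝ) * auxPhi (G+1) j + auxPhi (G+1) j := by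
        ring
      rw [e1, e2, Real.cos_sub, Real.cos_add]; ring
  have h := tel G
  have e : (2 * (G : ℝ) + 1) * auxPhi (G+1) j = Real.pi - auxPhi (G+1) j + (j : ℕ) * (2 * Real.pi) := by
    have : 2 * ((G + 1 : ℕ) : ℝ) * auxPhi (G+1) j = Real.pi * (2 * j + 1) := by
      unfold auxPhi; field_simp
    push_cast at this
    linarith
  rw [e, Real.cos_add_nat_mul_two_pi, Real.cos_pi_sub] at h
  unfold auxC
  rw [eq_div_iff hs.ne']
  linarith

theorem aux_L4 (F j : ℕ) (hj : j ≤ F) :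
    ∑ g ∈ Finset.Icc 1 (F - 1), Real.sin (Real.pi * g * j / F) ^ 2 / Real.sin (Real.pi * g / F)
      = ∑ i ∈ Finset.range j, auxC F i := by
  induction j with
  | zero => simp
  | succ j ih =>
    have hF : (F : ℝ) ≠ 0 := by exact_mod_cast (by omega : F ≠ 0)
    rw [Finset.sum_range_succ, ← ih (by omega), ← aux_L4a F j hj, ← Finset.sum_add_distrib]
    apply Finset.sum_congr rfl
    intro g hg
    rw [Finset.mem_Icc] at hg
    have hs := aux_sin_pos F g hg.1 (by omega)
    set a := Real.pi * g * j / F with ha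
    set b := Real.pi * g / F with hb
    have e1 : Real.pi * g * (j + 1 : ℕ) / F = a + b := by
      rw [ha, hb]; push_cast; field_simp
    have e2 : 2 * (g : ℝ) * auxPhi F j = a + (a + b) := by
      rw [ha, hb]; unfold auxPhi; field_simp; ring
    rw [e1, e2, div_add' _ _ _ hs.ne']
    congr 1
    rw [Real.sin_add a (a+b), Real.sin_add a b, Real.cos_add a b]
    have := Real.sin_sq_add_cos_sq a
    have := Real.sin_sq_add_cos_sq b
    have hca : Real.cos a ^ 2 = 1 - Real.sin a ^ 2 := by linarith
    have hcb : Real.cos b ^ 2 = 1 - Real.sin b ^ 2 := by linarith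
    ring_nf
    simp only [hca, hcb]
    ring

theorem aux_cot_le (F i : ℕ) (hi : 2 * i + 1 ≤ F) : auxC F i ≤ F / Real.pi * (2 / (2 * i + 1)) := by
  have hpi := Real.pi_pos
  have hF : (0 : ℝ) < F := by exact_mod_cast (by omega : 0 < F)
  have hp := auxPhi_pos F i (by omega)
  have hs := auxSin_pos F i (by omega)
  have hle : auxPhi F i ≤ Real.pi / 2 := by
    have : 2 * (i : ℝ) + 1 ≤ F := by exact_mod_cast hi
    unfold auxPhi
    rw [div_le_div_iff₀ (by positivity) (by positivity)]
    nlinarith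
  have e : (F : ℝ) / Real.pi * (2 / (2 * i + 1)) = 1 / auxPhi F i := by
    unfold auxPhi; field_simp
  rw [e]
  unfold auxC
  rw [div_le_div_iff₀ hs hp]
  rcases hle.lt_or_eq with h | h
  · have h1 := Real.lt_tan hp h
    have hc := Real.cos_pos_of_mem_Ioo ⟨by linarith, h⟩
    rw [Real.tan_eq_sin_div_cos, lt_div_iff₀ hc] at h1
    linarith
  · rw [h]; simp

theorem aux_cot_nonpos (F i : ℕ) (hi : F ≤ 2 * i + 1) (h2 : i < F) : auxC F i ≤ 0 := by
  have hpi := Real.pi_pos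
  have hF : (0 : ℝ) < F := by exact_mod_cast (by omega : 0 < F)
  have hs := auxSin_pos F i h2
  have hlt := auxPhi_lt F i h2
  have hle : Real.pi / 2 ≤ auxPhi F i := by
    have : (F : ℝ) ≤ 2 * i + 1 := by exact_mod_cast hi
    unfold auxPhi
    rw [div_le_div_iff₀ (by positivity) (by positivity)]
    nlinarith
  exact div_nonpos_of_nonpos_of_nonneg
    (Real.cos_nonpos_of_pi_div_two_le_of_le hle (by linarith)) hs.le

theorem aux_anti (F m : ℕ) (h : m + 1 < F) : auxC F (m + 1) ≤ auxC F m := by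
  have h1 := auxSin_pos F m (by omega)
  have h2 := auxSin_pos F (m + 1) h
  have hpi := Real.pi_pos
  have hF : (0 : ℝ) < F := by exact_mod_cast (by omega : 0 < F)
  unfold auxC
  rw [div_le_div_iff₀ h2 h1]
  have h3 : 0 ≤ Real.sin (auxPhi F (m + 1) - auxPhi F m) := by
    apply Real.sin_nonneg_of_nonneg_of_le_pi
    · have : auxPhi F (m + 1) - auxPhi F m = Real.pi / F := by
        unfold auxPhi; push_cast; field_simp; ring
      rw [this]; positivity
    · linarith [auxPhi_lt F (m + 1) h, auxPhi_pos F m (by omega)]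
  rw [Real.sin_sub] at h3
  linarith

theorem aux_harm (n : ℕ) : ∑ i ∈ Finset.range (n + 1), (2 : ℝ) / (2 * i + 1) ≤ Real.log (n + 1) + 2 := by
  induction n with
  | zero => simp
  | succ n ih =>
    rw [Finset.sum_range_succ]
    have hn : (0 : ℝ) < n + 1 := by positivity
    have h := Real.le_log_one_add_of_nonneg (x := 1 / ((n : ℝ) + 1)) (by positivity)
    have e : Real.log (1 + 1 / ((n : ℝ) + 1)) = Real.log (((n + 1 : ℕ) : ℝ) + 1) - Real.log (n + 1) := by
      rw [← Real.log_div (by positivity) (by positivity)]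
      congr 1; push_cast; field_simp
    have e2 : 2 * (1 / ((n : ℝ) + 1)) / (1 / ((n : ℝ) + 1) + 2) = 2 / (2 * ((n + 1 : ℕ) : ℝ) + 1) := by
      push_cast; field_simp; ring
    rw [e, e2] at h
    linarith

theorem aux_M (F j : ℕ) (hF : 2 ≤ F) (hj : j ≤ F) :
    ∑ i ∈ Finset.range j, auxC F i ≤ F / Real.pi * (Real.log F + 1.5) := by
  have hpi := Real.pi_pos
  have hF0 : (0 : ℝ) < F := by exact_mod_cast (by omega : 0 < F)
  have hb : ∀ k : ℕ, k ≤ F → ∑ i ∈ Finset.range k, auxC F i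
      ≤ F / Real.pi * ∑ i ∈ Finset.range (min k (F / 2)), (2 : ℝ) / (2 * i + 1) := by
    intro k
    induction k with
    | zero => intro _; simp
    | succ k ih =>
      intro hk
      rw [Finset.sum_range_succ]
      rcases Nat.lt_or_ge k (F / 2) with h | h
      · rw [min_eq_left (by omega), Finset.sum_range_succ, mul_add]
        have := ih (by omega)
        rw [min_eq_left (by omega)] at this
        linarith [aux_cot_le F k (by omega)]
      · have := ih (by omega)
        rw [min_eq_right (by omega)] at this ⊢
        linarith [aux_cot_nonpos F k (by omega) (by omega)]
  refine (hb j hj).trans ?_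
  apply mul_le_mul_of_nonneg_left _ (by positivity)
  obtain ⟨n, hn⟩ : ∃ n, F / 2 = n + 1 := ⟨F / 2 - 1, by omega⟩
  have h1 : ∑ i ∈ Finset.range (min j (F / 2)), (2 : ℝ) / (2 * i + 1)
      ≤ ∑ i ∈ Finset.range (n + 1), (2 : ℝ) / (2 * i + 1) := by
    apply Finset.sum_le_sum_of_subset_of_nonneg
    · apply Finset.range_mono; rw [hn]; exact min_le_right _ _
    · intros; positivity
  have h2 := aux_harm n
  have h3 : Real.log (2 * ((n : ℝ) + 1)) ≤ Real.log F := by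
    apply Real.log_le_log (by positivity)
    exact_mod_cast (by omega : 2 * (n + 1) ≤ F)
  rw [Real.log_mul (by norm_num) (by positivity)] at h3
  have := Real.log_two_gt_d9
  norm_num at *
  linarith

theorem aux_H (F : ℕ) (hF : 2 ≤ F) (n : ℤ) :
    ∑ g ∈ Finset.Icc 1 (F - 1), Real.sin (Real.pi * g * n / F) ^ 2 / Real.sin (Real.pi * g / F)
      ≤ F / Real.pi * (Real.log F + 1.5) := by
  have hpos : (0 : ℤ) < F := by exact_mod_cast (by omega : 0 < F)
  obtain ⟨t, ht⟩ := Int.eq_ofNat_of_zero_le (Int.emod_nonneg n hpos.ne')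
  have hlt : t < F := by have := Int.emod_lt_of_pos n hpos; omega
  refine le_trans (le_of_eq ?_) (aux_M F t hF hlt.le)
  rw [← aux_L4 F t hlt.le]
  apply Finset.sum_congr rfl
  intro g _
  have := aux_sin_sq_emod F (by omega) n (g : ℤ)
  rw [ht] at this
  simp only [Int.cast_natCast] at this
  rw [this]

theorem stmt_13 (F : ℕ) (hF : 1 ≤ F) (K : ℤ) :
    ∑ γ ∈ Finset.Icc 1 (F - 1),
        |Real.sin (Real.pi * γ * K / F)| / Real.sin (Real.pi * γ / F) ≤
      4 * F / Real.pi ^ 2 * (Real.log F + 1.5) := by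
  have hpi := Real.pi_pos
  have hF0 : (0 : ℝ) < F := by exact_mod_cast hF
  have hlog : 0 ≤ Real.log F := Real.log_natCast_nonneg F
  rcases hF.eq_or_lt with h | h2
  · subst h
    simp
    positivity
  set B := (F : ℝ) / Real.pi * (Real.log F + 1.5) with hB
  have hB0 : 0 ≤ B := by positivity
  have main : (F : ℝ) * ∑ γ ∈ Finset.Icc 1 (F - 1),
        |Real.sin (Real.pi * γ * K / F)| / Real.sin (Real.pi * γ / F)
      = ∑ m ∈ Finset.range (F - 1), (auxC F m - auxC F (m + 1)) *
        ∑ g ∈ Finset.Icc 1 (F - 1),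
          Real.sin (Real.pi * g * (((m + 1 : ℕ) * K : ℤ) : ℝ) / F) ^ 2 / Real.sin (Real.pi * g / F) := by
    simp_rw [Finset.mul_sum]
    rw [Finset.sum_comm]
    apply Finset.sum_congr rfl
    intro g _
    have h := aux_L3' F hF (g * K)
    have e : Real.pi * (((g : ℤ) * K : ℤ) : ℝ) / F = Real.pi * g * K / F := by push_cast; ring
    rw [e] at h
    rw [← mul_div_assoc, h, Finset.sum_div]
    apply Finset.sum_congr rfl
    intro m _
    rw [← mul_div_assoc]
    congr 4
    push_cast; ring
  have hle : (F : ℝ) * ∑ γ ∈ Finset.Icc 1 (F - 1),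
        |Real.sin (Real.pi * γ * K / F)| / Real.sin (Real.pi * γ / F)
      ≤ (auxC F 0 - auxC F (F - 1)) * B := by
    rw [main, ← Finset.sum_range_sub' (fun m => auxC F m), Finset.sum_mul]
    apply Finset.sum_le_sum
    intro m hm
    rw [Finset.mem_range] at hm
    exact mul_le_mul_of_nonneg_left (aux_H F h2 _) (sub_nonneg.mpr (aux_anti F m (by omega)))
  have hlast : auxC F (F - 1) = - auxC F 0 := by
    have e : auxPhi F (F - 1) = Real.pi - auxPhi F 0 := by
      unfold auxPhi
      rw [Nat.cast_sub hF]
      push_cast; field_simp; ring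
    unfold auxC
    rw [e, Real.cos_pi_sub, Real.sin_pi_sub, neg_div]
  have h0 : auxC F 0 ≤ 2 * F / Real.pi := by
    have := aux_cot_le F 0 (by omega)
    refine this.trans (le_of_eq ?_)
    simp; ring
  have hfin : (F : ℝ) * ∑ γ ∈ Finset.Icc 1 (F - 1),
        |Real.sin (Real.pi * γ * K / F)| / Real.sin (Real.pi * γ / F)
      ≤ F * (4 * F / Real.pi ^ 2 * (Real.log F + 1.5)) := by
    refine hle.trans ?_
    rw [hlast]
    calc (auxC F 0 - -auxC F 0) * B ≤ (4 * F / Real.pi) * B := by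
          apply mul_le_mul_of_nonneg_right _ hB0
          have : 4 * (F : ℝ) / Real.pi = 2 * F / Real.pi + 2 * F / Real.pi := by ring
          linarith
      _ = _ := by rw [hB]; field_simp
  exact le_of_mul_le_mul_left hfin hF0
end

section
/- For every integer λ ≥ 1, the series ∑_{n ≥ λ} τ(n)/n^{3/2} converges and satisfies ∑_{n ≥ λ} τ(n)/n^{3/2} ≤ (2·log λ + 7)/√λ. -/
noncomputable def gg (n : ℕ) : ℝ := 1 / ((n:ℝ) * √(n:ℝ))

lemma gg_nonneg (n : ℕ) : 0 ≤ gg n := by unfold gg; positivity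

lemma gg_mul (a b : ℕ) : gg (a*b) = gg a * gg b := by
  unfold gg
  push_cast
  rw [Real.sqrt_mul (by positivity)]
  rw [div_mul_div_comm]; congr 1
  · ring
  · ring

lemma prod_sum (I : Finset ℕ) : ∑ p ∈ I ×ˢ I, gg p.1 * gg p.2 = (∑ b ∈ I, gg b) * ∑ b ∈ I, gg b := by
  rw [Finset.sum_mul_sum, Finset.sum_product]

lemma tele (x : ℝ) (hx : 1 ≤ x) : 1 / (x * √x) ≤ 2 / √(x - 1/2) - 2 / √(x + 1/2) := by
  have hp : 0 < √(x - 1/2) := Real.sqrt_pos.2 (by linarith)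
  have hq : 0 < √(x + 1/2) := Real.sqrt_pos.2 (by linarith)
  have hs : 0 < √x := Real.sqrt_pos.2 (by linarith)
  have hp2 := Real.sq_sqrt (show 0 ≤ x - 1/2 by linarith)
  have hq2 := Real.sq_sqrt (show 0 ≤ x + 1/2 by linarith)
  have hs2 := Real.sq_sqrt (show 0 ≤ x by linarith)
  set p := √(x - 1/2)
  set q := √(x + 1/2)
  set s := √x
  have hpq : p * q ≤ x := by nlinarith [sq_nonneg (p - q)]
  have hsum : p + q ≤ 2 * s := by
    apply le_of_sq_le_sq _ (by positivity) |> fun h => h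
    nlinarith
  have e : 2 / p - 2 / q = 2 / (p * q * (p + q)) := by
    field_simp
    nlinarith
  rw [e, div_le_div_iff₀ (by positivity) (by positivity)]
  have : p * q * (p + q) ≤ x * (2 * s) := by gcongr
  linarith

lemma tail (m M : ℕ) (hm : 1 ≤ m) : ∑ b ∈ Finset.Icc m M, gg b ≤ 2 / √((m:ℝ) - 1/2) := by
  by_cases h : m ≤ M
  · have : ∑ b ∈ Finset.Icc m M, gg b ≤ 2 / √((m:ℝ) - 1/2) - 2 / √((M:ℝ) + 1/2) := by
      induction M, h using Nat.le_induction with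
      | base => 
        simp only [Finset.Icc_self, Finset.sum_singleton]
        exact tele m (by exact_mod_cast hm)
      | succ M h ih =>
        rw [Finset.sum_Icc_succ_top (by omega)]
        have := tele ((M+1:ℕ):ℝ) (by push_cast; linarith [Nat.cast_nonneg (α := ℝ) M])
        have e : (((M+1:ℕ):ℝ) - 1/2) = M + 1/2 := by push_cast; ring
        rw [e] at this
        unfold gg at *
        linarith
    have : 0 ≤ 2 / √((M:ℝ) + 1/2) := by positivity
    linarith
  · rw [Finset.Icc_eq_empty h, Finset.sum_empty]; positivity

/-- partial sums -/
lemma partial_le (l N : ℕ) (hl : 1 ≤ l) : ∃ M, 2 ≤ M ∧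
    ∑ n ∈ Finset.range N, (((n + l).divisors.card : ℝ)) / ((n : ℝ) + l) ^ (3 / 2 : ℝ) ≤
    ∑ p ∈ (Finset.Icc 1 M ×ˢ Finset.Icc 1 M).filter (fun p => l ≤ p.1 * p.2), gg p.1 * gg p.2 := by
  refine ⟨N + l + 2, by omega, ?_⟩
  have h1 : ∀ n ∈ Finset.range N, (((n + l).divisors.card : ℝ)) / ((n : ℝ) + l) ^ (3 / 2 : ℝ)
     = ∑ p ∈ (n+l).divisorsAntidiagonal, gg p.1 * gg p.2 := by
    intro n _
    have : ∀ p ∈ (n+l).divisorsAntidiagonal, gg p.1 * gg p.2 = gg (n + l) := by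
      intro p hp
      rw [← gg_mul, (Nat.mem_divisorsAntidiagonal.1 hp).1]
    rw [Finset.sum_congr rfl this, Finset.sum_const, nsmul_eq_mul, ← Nat.map_div_right_divisors,
      Finset.card_map]
    unfold gg
    have hpos : (0:ℝ) < (n:ℝ) + l := by
      have : (1:ℝ) ≤ l := by exact_mod_cast hl
      positivity
    rw [show (3/2:ℝ) = 1 + 1/2 by norm_num, Real.rpow_add hpos, Real.rpow_one, ← Real.sqrt_eq_rpow]
    push_cast
    ring
  rw [Finset.sum_congr rfl h1, ← Finset.sum_biUnion]
  · apply Finset.sum_le_sum_of_subset_of_nonneg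
    · intro p hp
      simp only [Finset.mem_biUnion, Finset.mem_range, Nat.mem_divisorsAntidiagonal] at hp
      obtain ⟨n, hn, h, h0⟩ := hp
      have ha : 0 < p.1 := Nat.pos_of_ne_zero (by intro h'; simp [h'] at h; omega)
      have hb : 0 < p.2 := Nat.pos_of_ne_zero (by intro h'; simp [h'] at h; omega)
      simp only [Finset.mem_filter, Finset.mem_product, Finset.mem_Icc]
      have := Nat.le_mul_of_pos_right p.1 hb
      have := Nat.le_mul_of_pos_left p.2 ha
      omega
    · intro p _ _
      exact mul_nonneg (gg_nonneg _) (gg_nonneg _)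
  · intro i _ j _ hij
    rw [Function.onFun, Finset.disjoint_left]
    intro p hp hq
    have := (Nat.mem_divisorsAntidiagonal.1 hp).1
    have := (Nat.mem_divisorsAntidiagonal.1 hq).1
    omega

lemma inner_le (l a M : ℕ) (ha : 1 ≤ a) (hal : a ≤ l) :
    ∑ b ∈ (Finset.Icc 1 M).filter (fun b => l ≤ a * b), gg b ≤ 2 / √((l:ℝ)/a - 1/2) := by
  have ha' : (0:ℝ) < a := by exact_mod_cast ha
  have hal' : (1:ℝ) ≤ (l:ℝ) / a := by rw [le_div_iff₀ ha']; simpa using hal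
  set m := ⌈(l:ℝ)/a⌉₊ with hm
  have hmle : (l:ℝ)/a ≤ m := Nat.le_ceil _
  have hm1 : 1 ≤ m := by
    have : (1:ℝ) ≤ m := hal'.trans hmle
    exact_mod_cast this
  calc _ ≤ ∑ b ∈ Finset.Icc m M, gg b := by
        apply Finset.sum_le_sum_of_subset_of_nonneg
        · intro b hb
          simp only [Finset.mem_filter, Finset.mem_Icc] at hb ⊢
          refine ⟨?_, hb.1.2⟩
          rw [hm, Nat.ceil_le, div_le_iff₀ ha']
          have := hb.2
          rw [mul_comm]
          exact_mod_cast this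
        · intro b _ _; exact gg_nonneg _
    _ ≤ _ := tail m M hm1
    _ ≤ _ := by
      have : 0 < √((l:ℝ)/a - 1/2) := Real.sqrt_pos.2 (by linarith)
      gcongr

lemma pair_le (l K M : ℕ) (h2 : l ≤ (K+1)^2) (h1 : K^2 < l) :
    ∑ p ∈ (Finset.Icc 1 M ×ˢ Finset.Icc 1 M).filter (fun p => l ≤ p.1 * p.2), gg p.1 * gg p.2
    ≤ 2 * ∑ a ∈ Finset.Icc 1 K, gg a * (2 / √((l:ℝ)/a - 1/2)) + (2 / √((K:ℝ) + 1/2))^2 := by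
  classical
  set I := Finset.Icc 1 M
  set A := (Finset.Icc 1 K ×ˢ I).filter (fun p => l ≤ p.1 * p.2)
  set B := (I ×ˢ Finset.Icc 1 K).filter (fun p => l ≤ p.1 * p.2)
  set C := Finset.Icc (K+1) M ×ˢ Finset.Icc (K+1) M
  have hn : ∀ p : ℕ × ℕ, 0 ≤ gg p.1 * gg p.2 := fun p => mul_nonneg (gg_nonneg _) (gg_nonneg _)
  have hsub : (I ×ˢ I).filter (fun p => l ≤ p.1 * p.2) ⊆ A ∪ (B ∪ C) := by
    intro p hp
    simp only [I, A, B, C, Finset.mem_union, Finset.mem_filter, Finset.mem_product, Finset.mem_Icc] at hp ⊢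
    omega
  have hu : ∀ X Y : Finset (ℕ × ℕ), ∑ p ∈ X ∪ Y, gg p.1 * gg p.2 ≤
      ∑ p ∈ X, gg p.1 * gg p.2 + ∑ p ∈ Y, gg p.1 * gg p.2 := by
    intro X Y
    rw [← Finset.sum_union_inter]
    have := Finset.sum_nonneg (s := X ∩ Y) (fun p _ => hn p)
    linarith
  have hA : ∑ p ∈ A, gg p.1 * gg p.2 ≤ ∑ a ∈ Finset.Icc 1 K, gg a * (2 / √((l:ℝ)/a - 1/2)) := by
    simp only [A]
    rw [Finset.sum_filter, Finset.sum_product]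
    apply Finset.sum_le_sum
    intro a ha
    rw [Finset.mem_Icc] at ha
    have := inner_le l a M ha.1 (by nlinarith)
    rw [← Finset.sum_filter]
    dsimp only
    rw [← Finset.mul_sum]
    exact mul_le_mul_of_nonneg_left this (gg_nonneg _)
  have hB : ∑ p ∈ B, gg p.1 * gg p.2 ≤ ∑ a ∈ Finset.Icc 1 K, gg a * (2 / √((l:ℝ)/a - 1/2)) := by
    simp only [B]
    rw [Finset.sum_filter, Finset.sum_product_right]
    apply Finset.sum_le_sum
    intro a ha
    rw [Finset.mem_Icc] at ha
    have := inner_le l a M ha.1 (by nlinarith)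
    rw [← Finset.sum_filter]
    dsimp only
    rw [← Finset.sum_mul, mul_comm]
    simp_rw [mul_comm _ a]
    exact mul_le_mul_of_nonneg_left this (gg_nonneg _)
  have hC : ∑ p ∈ C, gg p.1 * gg p.2 ≤ (2 / √((K:ℝ) + 1/2))^2 := by
    simp only [C]
    rw [prod_sum, ← sq]
    have := tail (K+1) M (by omega)
    rw [show (((K+1:ℕ):ℝ) - 1/2) = K + 1/2 by push_cast; ring] at this
    have h0 := Finset.sum_nonneg (s := Finset.Icc (K+1) M) (fun p _ => gg_nonneg p)
    gcongr
  have := Finset.sum_le_sum_of_subset_of_nonneg hsub (fun p _ _ => hn p)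
  have := hu A (B ∪ C)
  have := hu B C
  linarith

lemma term_le (l a K : ℕ) (ha : 1 ≤ a) (haK : a ≤ K) (h1 : K^2 < l) :
    gg a * (2 / √((l:ℝ)/a - 1/2)) ≤ (2 / √l) * (1/a + 1 / (4 * (l - K/2))) := by
  have ha' : (1:ℝ) ≤ a := by exact_mod_cast ha
  have haK' : (a:ℝ) ≤ K := by exact_mod_cast haK
  have h1' : (K:ℝ)^2 < l := by exact_mod_cast h1
  have hKl : (K:ℝ) < l := by nlinarith
  have hd : (0:ℝ) < l - a/2 := by linarith
  have hl : (0:ℝ) < l := by linarith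
  have e : (l:ℝ)/a - 1/2 = (l - a/2) / a := by field_simp
  rw [e, Real.sqrt_div hd.le]
  unfold gg
  have hsa : 0 < √(a:ℝ) := Real.sqrt_pos.2 (by linarith)
  have hsl : 0 < √(l:ℝ) := Real.sqrt_pos.2 (by linarith)
  have hsd : 0 < √((l:ℝ) - a/2) := Real.sqrt_pos.2 hd
  have hl2 := Real.sq_sqrt hl.le
  have hd2 := Real.sq_sqrt hd.le
  have e2 : 1 / ((a:ℝ) * √(a:ℝ)) * (2 / (√((l:ℝ) - a/2) / √(a:ℝ))) = (2 / √l) * ((1 / a) * (√l / √((l:ℝ) - a/2))) := by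
    field_simp
  rw [e2]
  have key : √(l:ℝ) / √((l:ℝ) - a/2) ≤ 1 + a / (4 * (l - a/2)) := by
    have : (1:ℝ) + a / (4 * (l - a/2)) = (1 + (√(l:ℝ) / √((l:ℝ) - a/2))^2)/2 := by
      rw [div_pow, hl2, hd2]
      generalize hD : (l:ℝ) - a/2 = D at hd
      have : (l:ℝ) = D + a/2 := by linarith
      rw [this]
      field_simp
      ring
    rw [this]
    nlinarith [sq_nonneg (√(l:ℝ) / √((l:ℝ) - a/2) - 1)]
  apply mul_le_mul_of_nonneg_left _ (by positivity)
  calc _ ≤ (1/(a:ℝ)) * (1 + a / (4 * (l - a/2))) := by gcongr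
    _ = 1 / a + 1 / (4 * (l - a/2)) := by field_simp
    _ ≤ _ := by
      have : (0:ℝ) < l - K/2 := by linarith
      gcongr

lemma log_lower (x : ℝ) (h0 : 0 < x) (h1 : x < 1) : 2 * x + 2/3 * x^3 ≤ Real.log ((1+x)/(1-x)) := by
  have h := Real.hasSum_log_sub_log_of_abs_lt_one (x := x) (by rw [abs_of_pos h0]; exact h1)
  have := sum_le_hasSum (Finset.range 2) (fun i _ => by positivity) h
  rw [Real.log_div (by linarith) (by linarith)]
  simp [Finset.sum_range_succ] at this
  norm_num at this
  linarith

lemma log32 : (0.4052:ℝ) ≤ Real.log (3/2) := by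
  have := log_lower (1/5) (by norm_num) (by norm_num)
  norm_num at this ⊢
  linarith

lemma harm_le (K : ℕ) (hK : 1 ≤ K) : ∑ a ∈ Finset.Icc 1 K, 1/(a:ℝ) ≤ Real.log (K + 1/2) + 0.5948 := by
  induction K, hK using Nat.le_induction with
  | base => have := log32; norm_num at *; linarith
  | succ K h ih =>
    rw [Finset.sum_Icc_succ_top (by omega)]
    have hK : (1:ℝ) ≤ K := by exact_mod_cast h
    have := log_lower (1/(2*(K+1))) (by positivity) (by rw [div_lt_one (by positivity)]; linarith)
    have e : (1 + 1 / (2 * ((K:ℝ) + 1))) / (1 - 1 / (2 * (K + 1))) = (K+1+1/2) / (K+1/2) := by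
      have : (2 * ((K:ℝ) + 1)) - 1 ≠ 0 := by nlinarith
      have : (K:ℝ) + 1/2 ≠ 0 := by positivity
      field_simp
      ring
    rw [e, Real.log_div (by positivity) (by positivity)] at this
    have : 0 ≤ 2/3 * (1 / (2 * ((K:ℝ) + 1)))^3 := by positivity
    have : 2 * (1/(2*((K:ℝ)+1))) = 1/(K+1) := by field_simp
    push_cast
    linarith

lemma num_ineq (l K : ℕ) (hl : 3 ≤ l) (h2 : l ≤ (K+1)^2) (h1 : K^2 < l) (s : ℝ) (hs : s = √(l:ℝ)) :
    K / ((l:ℝ) - K/2) + 4 * (s - (K+1/2))^2 / (s * (K + 1/2)) ≤ 0.6205 := by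
  have hl0 : (0:ℝ) ≤ l := by positivity
  have hs2 : s^2 = l := by rw [hs]; exact Real.sq_sqrt hl0
  have hs0 : 0 ≤ s := by rw [hs]; positivity
  have h2' : (l:ℝ) ≤ (K+1)^2 := by exact_mod_cast h2
  have h1' : (K:ℝ)^2 + 1 ≤ l := by exact_mod_cast h1
  have u : s ≤ K + 1 := by nlinarith
  have w : K ≤ s := by nlinarith
  rcases Nat.lt_or_ge K 3 with hK | hK
  · interval_cases K
    · omega
    · rcases (by omega : l = 3 ∨ l = 4) with rfl | rfl
      · have a1 : s ≤ 1.7321 := by norm_num at hs2; nlinarith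
        have a2 : 1.732 ≤ s := by norm_num at hs2; nlinarith
        have : 4 * (s - ((1:ℕ)+1/2))^2 / (s * ((1:ℕ) + 1/2)) ≤ 0.2 := by
          rw [div_le_iff₀ (by norm_num; linarith)]
          norm_num; nlinarith
        norm_num at *; linarith
      · have a1 : s = 2 := by norm_num at hs2; nlinarith
        subst a1; norm_num
    · have h5 : (5:ℝ) ≤ l := by exact_mod_cast h1
      have a2 : 2.236 ≤ s := by nlinarith
      rcases (by omega : l = 5 ∨ 6 ≤ l) with rfl | h6
      · have a1 : s ≤ 2.24 := by norm_num at hs2; nlinarith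
        have : 4 * (s - ((2:ℕ)+1/2))^2 / (s * ((2:ℕ) + 1/2)) ≤ 0.12 := by
          rw [div_le_iff₀ (by norm_num; linarith)]
          norm_num; nlinarith
        norm_num at *; linarith
      · have h6' : (6:ℝ) ≤ l := by exact_mod_cast h6
        have : 4 * (s - ((2:ℕ)+1/2))^2 / (s * ((2:ℕ) + 1/2)) ≤ 0.2 := by
          rw [div_le_iff₀ (by norm_num; linarith)]
          norm_num at *; nlinarith
        have : ((2:ℕ):ℝ) / ((l:ℝ) - (2:ℕ)/2) ≤ 0.4 := by
          rw [div_le_iff₀ (by norm_num; linarith)]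
          norm_num; linarith
        linarith
  · have hK' : (3:ℝ) ≤ K := by exact_mod_cast hK
    have b1 : K / ((l:ℝ) - K/2) ≤ 0.4 := by
      rw [div_le_iff₀ (by nlinarith)]
      nlinarith
    have b2 : 4 * (s - (K+1/2))^2 / (s * (K + 1/2)) ≤ 0.2 := by
      rw [div_le_iff₀ (by nlinarith)]
      have : (s - (K+1/2))^2 ≤ 1/4 := by nlinarith
      nlinarith
    linarith

lemma main_bound (l K : ℕ) (hl : 3 ≤ l) (h2 : l ≤ (K+1)^2) (h1 : K^2 < l) :
    2 * ∑ a ∈ Finset.Icc 1 K, gg a * (2 / √((l:ℝ)/a - 1/2)) + (2 / √((K:ℝ) + 1/2))^2 ≤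
    (2 * Real.log l + 7) / Real.sqrt l := by
  have hK : 1 ≤ K := by
    rcases Nat.eq_zero_or_pos K with h | h
    · subst h; omega
    · exact h
  have hK' : (1:ℝ) ≤ K := by exact_mod_cast hK
  have hl' : (3:ℝ) ≤ l := by exact_mod_cast hl
  have h1' : (K:ℝ)^2 < l := by exact_mod_cast h1
  have hsum : ∑ a ∈ Finset.Icc 1 K, gg a * (2 / √((l:ℝ)/a - 1/2)) ≤
      (2 / √l) * (∑ a ∈ Finset.Icc 1 K, 1/(a:ℝ) + K * (1 / (4 * (l - K/2)))) := by
    calc _ ≤ ∑ a ∈ Finset.Icc 1 K, (2 / √l) * (1/(a:ℝ) + 1 / (4 * ((l:ℝ) - K/2))) := by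
          apply Finset.sum_le_sum
          intro a ha
          rw [Finset.mem_Icc] at ha
          exact term_le l a K ha.1 ha.2 h1
      _ = _ := by
          rw [← Finset.mul_sum, Finset.sum_add_distrib]
          simp
  have hn := num_ineq l K hl h2 h1 _ rfl
  have hh := harm_le K hK
  have hs2 := Real.sq_sqrt (show (0:ℝ) ≤ l by linarith)
  have hs : 0 < √(l:ℝ) := Real.sqrt_pos.2 (by linarith)
  have hlog : Real.log l = 2 * Real.log √(l:ℝ) := by
    rw [Real.log_sqrt (by linarith)]; ring
  rw [hlog, div_pow, Real.sq_sqrt (by positivity), le_div_iff₀ hs]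
  set s := √(l:ℝ)
  set t := (K:ℝ) + 1/2 with ht
  have ht0 : 0 < t := by positivity
  have hd : (0:ℝ) < l - K/2 := by nlinarith
  have hr : Real.log t - Real.log s ≤ t / s - 1 := by
    rw [← Real.log_div ht0.ne' hs.ne']
    exact Real.log_le_sub_one_of_pos (by positivity)
  have e1 : 4 * (s - t)^2 / (s * t) = 4 * (s / t) + 4 * (t / s) - 8 := by
    field_simp; ring
  have e2 : (2 / s * (∑ a ∈ Finset.Icc 1 K, 1/(a:ℝ) + K * (1 / (4 * ((l:ℝ) - K/2))))) * s
     = 2 * ∑ a ∈ Finset.Icc 1 K, 1/(a:ℝ) + (K / ((l:ℝ) - K/2)) / 2 := by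
    field_simp; ring
  have e3 : (2:ℝ)^2 / t * s = 4 * (s/t) := by ring
  have := mul_le_mul_of_nonneg_right hsum hs.le
  rw [add_mul, e3, mul_assoc]
  linarith

lemma G_le (M : ℕ) (hM : 2 ≤ M) : ∑ b ∈ Finset.Icc 1 M, gg b ≤ 2.62 := by
  rw [← Finset.add_sum_Ioc_eq_sum_Icc (by omega), ← Finset.Icc_add_one_left_eq_Ioc,
    ← Finset.add_sum_Ioc_eq_sum_Icc (by omega), ← Finset.Icc_add_one_left_eq_Ioc]
  have := tail 3 M (by norm_num)
  have g1 : gg 1 = 1 := by simp [gg]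
  have g2 : gg 2 ≤ 0.3537 := by
    have : 1.414 ≤ √(2:ℝ) := Real.le_sqrt_of_sq_le (by norm_num)
    unfold gg
    rw [div_le_iff₀ (by positivity)]
    norm_num; linarith
  have g3 : 2 / √(((3:ℕ):ℝ) - 1/2) ≤ 1.2652 := by
    have : 1.581 ≤ √(((3:ℕ):ℝ) - 1/2) := Real.le_sqrt_of_sq_le (by norm_num)
    rw [div_le_iff₀ (by linarith)]
    linarith
  norm_num at *
  linarith

lemma total (l M : ℕ) (hl : 1 ≤ l) (hM : 2 ≤ M) :
    ∑ p ∈ (Finset.Icc 1 M ×ˢ Finset.Icc 1 M).filter (fun p => l ≤ p.1 * p.2), gg p.1 * gg p.2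
    ≤ (2 * Real.log l + 7) / Real.sqrt l := by
  have hn : ∀ p : ℕ × ℕ, 0 ≤ gg p.1 * gg p.2 := fun p => mul_nonneg (gg_nonneg _) (gg_nonneg _)
  have hG := G_le M hM
  have hG0 := Finset.sum_nonneg (s := Finset.Icc 1 M) (fun p _ => gg_nonneg p)
  rcases (by omega : l = 1 ∨ l = 2 ∨ 3 ≤ l) with rfl | rfl | h3
  · have := Finset.sum_le_sum_of_subset_of_nonneg (Finset.filter_subset (fun p : ℕ × ℕ => 1 ≤ p.1 * p.2) (Finset.Icc 1 M ×ˢ Finset.Icc 1 M)) (fun p _ _ => hn p)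
    rw [prod_sum] at this
    refine this.trans ?_
    norm_num
    nlinarith
  · have : (Finset.Icc 1 M ×ˢ Finset.Icc 1 M).filter (fun p : ℕ × ℕ => 2 ≤ p.1 * p.2) ⊆ (Finset.Icc 1 M ×ˢ Finset.Icc 1 M).erase (1,1) := by
      intro p hp
      rw [Finset.mem_filter] at hp
      rw [Finset.mem_erase]
      refine ⟨?_, hp.1⟩
      rintro rfl
      simp at hp
    have := Finset.sum_le_sum_of_subset_of_nonneg this (fun p _ _ => hn p)
    rw [Finset.sum_erase_eq_sub (by simp; omega), prod_sum] at this
    refine this.trans ?_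
    have g1 : gg 1 = 1 := by simp [gg]
    have h2 : √(2:ℝ) ≤ 1.4143 := Real.sqrt_le_iff.2 (by norm_num)
    have := Real.log_two_gt_d9
    simp only [g1]
    rw [le_div_iff₀ (by positivity)]
    push_cast
    have hX : (∑ b ∈ Finset.Icc 1 M, gg b) * (∑ b ∈ Finset.Icc 1 M, gg b) - 1 * 1 ≤ 5.87 := by nlinarith
    have := mul_le_mul_of_nonneg_right hX (Real.sqrt_nonneg 2)
    nlinarith
  · obtain ⟨K, hK1, hK2⟩ : ∃ K, K^2 < l ∧ l ≤ (K+1)^2 := by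
      refine ⟨Nat.sqrt (l-1), ?_, ?_⟩
      · have := Nat.sqrt_le' (l-1); omega
      · have := Nat.lt_succ_sqrt' (l-1); simp only [Nat.succ_eq_add_one] at this; omega
    exact (pair_le l K M hK2 hK1).trans (main_bound l K h3 hK2 hK1)

theorem stmt_14 (l : ℕ) (hl : 1 ≤ l) :
    Summable (fun n : ℕ => (((n + l).divisors.card : ℝ)) / ((n : ℝ) + l) ^ (3 / 2 : ℝ)) ∧
      ∑' n : ℕ, (((n + l).divisors.card : ℝ)) / ((n : ℝ) + l) ^ (3 / 2 : ℝ) ≤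
        (2 * Real.log l + 7) / Real.sqrt l := by
  have h0 : ∀ n : ℕ, 0 ≤ (((n + l).divisors.card : ℝ)) / ((n : ℝ) + l) ^ (3 / 2 : ℝ) := by
    intro n; positivity
  have hN : ∀ N : ℕ, ∑ n ∈ Finset.range N, (((n + l).divisors.card : ℝ)) / ((n : ℝ) + l) ^ (3 / 2 : ℝ) ≤ (2 * Real.log l + 7) / Real.sqrt l := by
    intro N
    obtain ⟨M, hM, h⟩ := partial_le l N hl
    exact h.trans (total l M hl hM)
  exact ⟨summable_of_sum_range_le h0 hN, Real.tsum_le_of_sum_range_le h0 hN⟩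
end

section
/- The integral ∫₀^∞ |J₂(y)|/y dy converges and is at most 1.1; equivalently, the total variation on [0, ∞) of the function y ↦ J₁(y)/y (extended by 1/2 at y = 0) is at most 1.1. -/
open MeasureTheory

/-- The Bessel function of the first kind of order 2. -/
noncomputable def J2 (y : ℝ) : ℝ :=
  ∑' k : ℕ, (-1 : ℝ) ^ k / (Nat.factorial k * Nat.factorial (k + 2)) * (y / 2) ^ (2 * k + 2)

/-- coefficients of the auxiliary series -/
noncomputable def bA (n k : ℕ) : ℝ := (-1 : ℝ) ^ k / (Nat.factorial k * Nat.factorial (k + n))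

noncomputable def bG (n : ℕ) (x : ℝ) : ℝ := ∑' k : ℕ, bA n k * x ^ k

lemma bA_abs (n k : ℕ) : |bA n k| = 1 / ((Nat.factorial k : ℝ) * Nat.factorial (k + n)) := by
  unfold bA
  rw [abs_div, abs_pow, abs_neg, abs_one, one_pow, abs_of_pos (by positivity)]

lemma bA_abs_le (n k : ℕ) : |bA n k| ≤ 1 / (Nat.factorial k : ℝ) := by
  rw [bA_abs]
  apply one_div_le_one_div_of_le (by positivity)
  have h : (1 : ℝ) ≤ Nat.factorial (k + n) := by
    exact_mod_cast Nat.one_le_iff_ne_zero.mpr (Nat.factorial_ne_zero _)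
  have h2 : (0 : ℝ) < Nat.factorial k := by positivity
  nlinarith

lemma bA_succ (n k : ℕ) : ((k : ℝ) + 1) * bA n (k + 1) = - bA (n + 1) k := by
  unfold bA
  rw [Nat.factorial_succ k, show k + 1 + n = k + (n + 1) by ring, pow_succ]
  push_cast
  have h2 : (0 : ℝ) < Nat.factorial k := by positivity
  have h3 : (0 : ℝ) < Nat.factorial (k + (n + 1)) := by positivity
  have h4 : (0 : ℝ) < (k : ℝ) + 1 := by positivity
  field_simp

lemma bA_summable (n : ℕ) (x : ℝ) : Summable (fun k : ℕ => bA n k * x ^ k) := by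
  apply Summable.of_norm_bounded (g := fun k : ℕ => |x| ^ k / (Nat.factorial k : ℝ))
    (Real.summable_pow_div_factorial |x|)
  intro k
  rw [Real.norm_eq_abs, abs_mul, abs_pow]
  have := bA_abs_le n k
  calc |bA n k| * |x| ^ k ≤ (1 / (Nat.factorial k : ℝ)) * |x| ^ k := by gcongr
    _ = _ := by ring

lemma bG_hasDerivAt (n : ℕ) (x : ℝ) : HasDerivAt (bG n) (- bG (n + 1) x) x := by
  set R : ℝ := |x| + 1 with hR
  have hu : Summable (fun k : ℕ => (k : ℝ) * (1 / (Nat.factorial k : ℝ)) * R ^ (k - 1)) := by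
    rw [← summable_nat_add_iff 1]
    refine (Real.summable_pow_div_factorial R).congr ?_
    intro k
    rw [Nat.factorial_succ]
    push_cast
    have h2 : (0 : ℝ) < Nat.factorial k := by positivity
    have h4 : (0 : ℝ) < (k : ℝ) + 1 := by positivity
    field_simp
  have key := hasDerivAt_tsum_of_isPreconnected (𝕜 := ℝ) (F := ℝ)
    (g := fun (k : ℕ) (y : ℝ) => bA n k * y ^ k)
    (g' := fun (k : ℕ) (y : ℝ) => bA n k * ((k : ℝ) * y ^ (k - 1))) hu
    (t := Metric.ball (0 : ℝ) R) Metric.isOpen_ball (convex_ball (0 : ℝ) R).isPreconnected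
    (fun k y _ => (hasDerivAt_pow k y).const_mul (bA n k))
    (fun k y hy => by
      have hy' : |y| ≤ R := by
        have := Metric.mem_ball.mp hy
        rw [Real.dist_eq, sub_zero] at this
        exact this.le
      rw [Real.norm_eq_abs, abs_mul, abs_mul, abs_pow, Nat.abs_cast]
      have := bA_abs_le n k
      calc |bA n k| * ((k : ℝ) * |y| ^ (k - 1))
          ≤ (1 / (Nat.factorial k : ℝ)) * ((k : ℝ) * R ^ (k - 1)) := by gcongr
        _ = _ := by ring)
    (y₀ := 0) (by simp [hR]; positivity) (bA_summable n 0) (y := x)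
    (by simp [hR])
  have e : (∑' k : ℕ, bA n k * ((k : ℝ) * x ^ (k - 1))) = - bG (n + 1) x := by
    rw [tsum_eq_zero_add' ?_]
    · unfold bG
      simp only [Nat.cast_zero, zero_mul, mul_zero, zero_add, ← tsum_neg, Nat.add_sub_cancel]
      congr 1
      ext k
      have := bA_succ n k
      push_cast
      linear_combination x ^ k * this
    · refine (bA_summable (n + 1) x).neg.congr ?_
      intro k
      have := bA_succ n k
      simp only [Nat.add_sub_cancel]
      push_cast
      linear_combination - x ^ k * this
  rw [← e]
  exact key

lemma bG_rec (x : ℝ) : bG 1 x + x * bG 3 x = 2 * bG 2 x := by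
  unfold bG
  rw [(bA_summable 1 x).tsum_eq_zero_add, (bA_summable 2 x).tsum_eq_zero_add, mul_add,
    ← tsum_mul_left, ← tsum_mul_left, add_assoc, ← Summable.tsum_add]
  · congr 1
    · simp [bA]
    · congr 1
      ext k
      unfold bA
      rw [show k + 1 + 1 = k + 2 by ring, show k + 1 + 2 = k + 2 + 1 by ring,
        show k + 3 = k + 2 + 1 by ring, Nat.factorial_succ k, Nat.factorial_succ (k + 2), pow_succ,
        pow_succ]
      push_cast
      have h2 : (0 : ℝ) < Nat.factorial k := by positivity
      have h3 : (0 : ℝ) < Nat.factorial (k + 2) := by positivity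
      have h4 : (0 : ℝ) < (k : ℝ) + 1 := by positivity
      have h5 : (0 : ℝ) < (k : ℝ) + 2 + 1 := by positivity
      field_simp
      ring
  · exact (summable_nat_add_iff 1).mpr (bA_summable 1 x)
  · exact (bA_summable 3 x).mul_left x

lemma bG_approx (n N : ℕ) (x : ℝ) (hx : 0 ≤ x) (h : 2 * x ≤ ((N : ℝ) + 1) * (N + n + 1)) :
    |bG n x - ∑ k ∈ Finset.range N, bA n k * x ^ k| ≤
      2 * (x ^ N / ((Nat.factorial N : ℝ) * Nat.factorial (N + n))) := by
  set c : ℝ := x ^ N / ((Nat.factorial N : ℝ) * Nat.factorial (N + n)) with hc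
  have hb : ∀ j : ℕ, |bA n (j + N) * x ^ (j + N)| ≤ c * (1 / 2) ^ j := by
    intro j
    rw [abs_mul, bA_abs, abs_of_nonneg (pow_nonneg hx _)]
    induction j with
    | zero => simp [hc]; apply le_of_eq; ring
    | succ j ih =>
      rw [show j + 1 + N = (j + N) + 1 by ring, show j + N + 1 + n = (j + N + n) + 1 by ring,
        Nat.factorial_succ (j + N), Nat.factorial_succ (j + N + n), pow_succ, pow_succ]
      push_cast
      have h2 : (0 : ℝ) < Nat.factorial (j + N) := by positivity
      have h3 : (0 : ℝ) < Nat.factorial (j + N + n) := by positivity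
      have h4 : (0 : ℝ) < (j : ℝ) + N + 1 := by positivity
      have h5 : (0 : ℝ) < (j : ℝ) + N + n + 1 := by positivity
      have h6 : x / (((j : ℝ) + N + 1) * ((j : ℝ) + N + n + 1)) ≤ 1 / 2 := by
        rw [div_le_div_iff₀ (by positivity) (by norm_num)]
        have hj : (0 : ℝ) ≤ j := by positivity
        have hN : (0 : ℝ) ≤ N := by positivity
        have hn : (0 : ℝ) ≤ n := by positivity
        have : ((N : ℝ) + 1) * (N + n + 1) ≤ ((j : ℝ) + N + 1) * ((j : ℝ) + N + n + 1) := by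
          gcongr <;> linarith
        linarith
      have h7 : 0 ≤ x / (((j : ℝ) + N + 1) * ((j : ℝ) + N + n + 1)) := by positivity
      calc _ = (1 / ((Nat.factorial (j + N) : ℝ) * Nat.factorial (j + N + n)) * x ^ (j + N)) *
            (x / (((j : ℝ) + N + 1) * ((j : ℝ) + N + n + 1))) := by field_simp
        _ ≤ (c * (1 / 2) ^ j) * (1 / 2) := by
            apply mul_le_mul ih h6 h7
            positivity
        _ = _ := by ring
  have hs : HasSum (fun j : ℕ => c * (1 / 2 : ℝ) ^ j) (c * 2) := hasSum_geometric_two.mul_left c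
  have e : bG n x - ∑ k ∈ Finset.range N, bA n k * x ^ k =
      ∑' j : ℕ, bA n (j + N) * x ^ (j + N) := by
    unfold bG
    rw [← (bA_summable n x).sum_add_tsum_nat_add N]
    ring
  rw [e, mul_comm 2 c]
  exact tsum_of_norm_bounded (f := fun j : ℕ => bA n (j + N) * x ^ (j + N)) hs hb

noncomputable def J1 (y : ℝ) : ℝ := y / 2 * bG 1 (y ^ 2 / 4)

lemma J2_eq (y : ℝ) : J2 y = y ^ 2 / 4 * bG 2 (y ^ 2 / 4) := by
  unfold J2 bG
  rw [← tsum_mul_left]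
  congr 1
  ext k
  unfold bA
  rw [show y ^ 2 / 4 = (y / 2) ^ 2 by ring, ← pow_mul]
  ring

lemma sq4_deriv (y : ℝ) : HasDerivAt (fun y : ℝ => y ^ 2 / 4) (y / 2) y := by
  have := (hasDerivAt_pow 2 y).div_const 4
  refine this.congr_deriv ?_
  norm_num
  ring

lemma bGsq_deriv (n : ℕ) (y : ℝ) :
    HasDerivAt (fun y : ℝ => bG n (y ^ 2 / 4)) (- bG (n + 1) (y ^ 2 / 4) * (y / 2)) y :=
  HasDerivAt.comp (h₂ := bG n) (h := fun y : ℝ => y ^ 2 / 4) y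
    (bG_hasDerivAt n (y ^ 2 / 4)) (sq4_deriv y)

lemma J1_deriv (y : ℝ) (hy : 0 < y) : HasDerivAt J1 (J1 y / y - J2 y) y := by
  have h := ((hasDerivAt_id y).div_const 2).mul (bGsq_deriv 1 y)
  refine HasDerivAt.congr_deriv (f := J1) h ?_
  rw [J2_eq]
  unfold J1
  simp only [id]
  field_simp
  ring

lemma J2_deriv (y : ℝ) (hy : 0 < y) : HasDerivAt J2 (J1 y - 2 * J2 y / y) y := by
  have h := (sq4_deriv y).mul (bGsq_deriv 2 y)
  have e : J2 = fun y : ℝ => y ^ 2 / 4 * bG 2 (y ^ 2 / 4) := funext J2_eq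
  have := bG_rec (y ^ 2 / 4)
  rw [J2_eq]
  rw [e]
  refine HasDerivAt.congr_deriv h ?_
  unfold J1
  field_simp
  linear_combination (-4) * this

lemma J1_five : |J1 5 + 0.327579| ≤ 0.00001 := by
  have h := bG_approx 1 10 (25 / 4) (by norm_num) (by norm_num)
  have e : J1 5 = 5 / 2 * bG 1 (25 / 4) := by unfold J1; norm_num
  rw [e]
  simp only [Finset.sum_range_succ, Finset.sum_range_zero, bA, Nat.factorial, abs_le] at h ⊢
  norm_num at h ⊢
  constructor <;> linarith [h.1, h.2]

lemma J2_five : |J2 5 - 0.046565| ≤ 0.00001 := by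
  have h := bG_approx 2 10 (25 / 4) (by norm_num) (by norm_num)
  have e : J2 5 = 25 / 4 * bG 2 (25 / 4) := by rw [J2_eq]; norm_num
  rw [e]
  simp only [Finset.sum_range_succ, Finset.sum_range_zero, bA, Nat.factorial, abs_le] at h ⊢
  norm_num at h ⊢
  constructor <;> linarith [h.1, h.2]

lemma bG2_nonneg (x : ℝ) (hx : 0 ≤ x) (hx' : x ≤ 25 / 4) : 0 ≤ bG 2 x := by
  have h := bG_approx 2 6 x hx (by norm_num; linarith)
  simp only [Finset.sum_range_succ, Finset.sum_range_zero, bA, Nat.factorial, abs_le] at h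
  norm_num at h
  obtain ⟨t, rfl⟩ : ∃ t, x = 25 / 4 - t := ⟨25 / 4 - x, by ring⟩
  have ht : 0 ≤ t := by linarith
  have ht' : t ≤ 25 / 4 := by linarith
  have := h.1
  have h2 := pow_nonneg ht 2
  have h3 := pow_nonneg ht 3
  have h4 := pow_nonneg ht 4
  have h5 := pow_nonneg ht 5
  have h6 : 0 ≤ t ^ 5 * (25 / 4 - t) := by positivity
  have h7 : 0 ≤ t ^ 3 * (25 / 4 - t) := by positivity
  ring_nf at this h6 h7 ⊢
  linarith


/-- The derivative of u = √y J₂, divided by √y. -/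
noncomputable def bP (y : ℝ) : ℝ := J1 y - 3 / 2 * (J2 y / y)

noncomputable def bQ (y : ℝ) : ℝ := 1 - 15 / 4 / y ^ 2

lemma bQ_pos (y : ℝ) (hy : 5 ≤ y) : 0 < bQ y := by
  unfold bQ
  rw [sub_pos, div_lt_one (by positivity)]
  nlinarith

lemma bQ_deriv (y : ℝ) (hy : 0 < y) : HasDerivAt bQ (15 / 2 / y ^ 3) y := by
  have h := ((hasDerivAt_const y (15 / 4 : ℝ)).div (hasDerivAt_pow 2 y) (by positivity)).const_sub 1
  refine HasDerivAt.congr_deriv (f := bQ) h ?_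
  field_simp
  norm_num
  ring

lemma bP_deriv (y : ℝ) (hy : 0 < y) :
    HasDerivAt bP (- bQ y * J2 y - bP y / (2 * y)) y := by
  have h := (J1_deriv y hy).sub
    (((J2_deriv y hy).div (hasDerivAt_id y) hy.ne').const_mul (3 / 2))
  refine HasDerivAt.congr_deriv (f := bP) h ?_
  unfold bP bQ
  simp only [id]
  field_simp
  ring

lemma J2_deriv' (y : ℝ) (hy : 0 < y) :
    HasDerivAt J2 (bP y - J2 y / (2 * y)) y := by
  refine (J2_deriv y hy).congr_deriv ?_
  unfold bP
  field_simp
  ring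

/-- energy over `q` -/
noncomputable def bF (y : ℝ) : ℝ := y * (bP y ^ 2 / bQ y + J2 y ^ 2)

lemma bF_deriv (y : ℝ) (hy : 5 ≤ y) :
    HasDerivAt bF (- (y * (15 / 2 / y ^ 3) * bP y ^ 2 / bQ y ^ 2)) y := by
  have hy0 : 0 < y := by linarith
  have hq := bQ_pos y hy
  have h := (hasDerivAt_id y).mul (((((bP_deriv y hy0).pow 2).div (bQ_deriv y hy0) hq.ne')).add
    ((J2_deriv' y hy0).pow 2))
  refine HasDerivAt.congr_deriv (f := bF) h ?_
  simp only [id, Pi.add_apply, Pi.div_apply, Pi.pow_apply]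
  field_simp
  ring

lemma bF_five : bF 5 ≤ 0.698 := by
  have h1 := abs_le.mp J1_five
  have h2 := abs_le.mp J2_five
  unfold bF bP bQ
  have hP : (J1 5 - 3 / 2 * (J2 5 / 5)) ^ 2 ≤ 0.34157 ^ 2 := by
    apply sq_le_sq'
    · norm_num at *
      linarith
    · norm_num at *
      linarith
  have hJ : J2 5 ^ 2 ≤ 0.046576 ^ 2 := by
    apply sq_le_sq'
    · norm_num at *
      linarith
    · norm_num at *
      linarith
  norm_num at *
  linarith

lemma J2_sq_bound (y : ℝ) (hy : 5 ≤ y) : y * J2 y ^ 2 ≤ 0.698 := by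
  have hanti : AntitoneOn bF (Set.Ici 5) := by
    apply antitoneOn_of_deriv_nonpos (convex_Ici 5)
    · intro z hz
      exact (bF_deriv z hz).continuousAt.continuousWithinAt
    · intro z hz
      rw [interior_Ici] at hz
      exact (bF_deriv z (le_of_lt hz)).differentiableAt.differentiableWithinAt
    · intro z hz
      rw [interior_Ici] at hz
      have hz' : 5 ≤ z := le_of_lt hz
      rw [(bF_deriv z hz').deriv]
      have : 0 < z := by linarith
      rw [neg_nonpos]
      positivity
  have h := hanti (Set.mem_Ici.mpr le_rfl) (Set.mem_Ici.mpr hy) hy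
  have h5 := bF_five
  have hq := bQ_pos y hy
  have hy0 : 0 < y := by linarith
  have h6 : y * J2 y ^ 2 ≤ bF y := by
    unfold bF
    have : 0 ≤ y * (bP y ^ 2 / bQ y) := by positivity
    linarith
  linarith

noncomputable def bV (y : ℝ) : ℝ :=
  - (√y * (bP y ^ 2 + J2 y * bP y / (2 * y) + (1 - 27 / 8 / y ^ 2) * J2 y ^ 2))
    - 33 / 8 * 0.698 / (y ^ 2 * √y)

noncomputable def bW (y : ℝ) : ℝ := 1 / 2 * (1.69 * bV y - 2 / (1.69 * √y))

lemma bV_deriv (y : ℝ) (hy : 0 < y) :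
    HasDerivAt bV (J2 y ^ 2 / √y + 165 / 16 * (0.698 - y * J2 y ^ 2) / (y ^ 3 * √y)) y := by
  have hs := Real.hasDerivAt_sqrt hy.ne'
  have hsp := Real.sqrt_pos.mpr hy
  have hJ := J2_deriv' y hy
  have hP := bP_deriv y hy
  have hid := hasDerivAt_id y
  have hc := ((hasDerivAt_const y (27 / 8 : ℝ)).div (hasDerivAt_pow 2 y) (by positivity)).const_sub 1
  have h := (hs.mul (((hP.pow 2).add ((hJ.mul hP).div (hid.const_mul 2) (by simp [hy.ne']))).add
    (hc.mul (hJ.pow 2)))).neg.sub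
    ((hasDerivAt_const y (33 / 8 * 0.698 : ℝ)).div ((hasDerivAt_pow 2 y).mul hs)
      (by simp only [Pi.mul_apply]; positivity))
  refine HasDerivAt.congr_deriv (f := bV) h ?_
  simp only [id, Pi.add_apply, Pi.div_apply, Pi.pow_apply, Pi.mul_apply, bQ]
  have e : y = √y ^ 2 := (Real.sq_sqrt hy.le).symm
  generalize √y = r at *
  generalize J2 y = a at *
  generalize bP y = b at *
  subst e
  have : r ≠ 0 := hsp.ne'
  field_simp
  ring

lemma bW_deriv (y : ℝ) (hy : 0 < y) :
    HasDerivAt bW (1 / 2 * (1.69 * (J2 y ^ 2 / √y +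
      165 / 16 * (0.698 - y * J2 y ^ 2) / (y ^ 3 * √y)) + 1 / (1.69 * (y * √y)))) y := by
  have hs := Real.hasDerivAt_sqrt hy.ne'
  have hsp := Real.sqrt_pos.mpr hy
  have h := (((bV_deriv y hy).const_mul 1.69).sub
    ((hasDerivAt_const y (2 : ℝ)).div (hs.const_mul 1.69) (by positivity))).const_mul (1 / 2)
  refine HasDerivAt.congr_deriv (f := bW) h ?_
  have e : y = √y ^ 2 := (Real.sq_sqrt hy.le).symm
  congr 1
  rw [sub_eq_add_neg]
  congr 1
  generalize √y = r at *
  subst e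
  have : r ≠ 0 := hsp.ne'
  field_simp
  ring

lemma bW_deriv_ge (y : ℝ) (hy : 5 ≤ y) : |J2 y| / y ≤ 1 / 2 * (1.69 * (J2 y ^ 2 / √y +
      165 / 16 * (0.698 - y * J2 y ^ 2) / (y ^ 3 * √y)) + 1 / (1.69 * (y * √y))) := by
  have hy0 : 0 < y := by linarith
  have hsp := Real.sqrt_pos.mpr hy0
  have hb := J2_sq_bound y hy
  have h1 : 0 ≤ 165 / 16 * (0.698 - y * J2 y ^ 2) / (y ^ 3 * √y) := by
    apply div_nonneg _ (by positivity)
    linarith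
  have h2 : |J2 y| / y ≤ 1 / 2 * (1.69 * (J2 y ^ 2 / √y) + 1 / (1.69 * (y * √y))) := by
    rw [← sq_abs (J2 y)]
    have e : y = √y ^ 2 := (Real.sq_sqrt hy0.le).symm
    generalize |J2 y| = a at *
    generalize √y = r at *
    have hh : 1 / 2 * (1.69 * (a ^ 2 / r) + 1 / (1.69 * (y * r))) - a / y =
        (1.69 * a * r - 1) ^ 2 / (2 * 1.69 * r ^ 3) := by
      subst e
      field_simp
      ring
    have : 0 ≤ (1.69 * a * r - 1) ^ 2 / (2 * 1.69 * r ^ 3) := by positivity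
    linarith
  linarith

lemma bW_nonpos (y : ℝ) (hy : 5 ≤ y) : bW y ≤ 0 := by
  have hy0 : 0 < y := by linarith
  have hsp := Real.sqrt_pos.mpr hy0
  have h1 : 0 ≤ bP y ^ 2 + J2 y * bP y / (2 * y) + (1 - 27 / 8 / y ^ 2) * J2 y ^ 2 := by
    have e : bP y ^ 2 + J2 y * bP y / (2 * y) + (1 - 27 / 8 / y ^ 2) * J2 y ^ 2 =
      (bP y + J2 y / (4 * y)) ^ 2 + (1 - 55 / 16 / y ^ 2) * J2 y ^ 2 := by
      field_simp
      ring
    rw [e]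
    have : 0 ≤ 1 - 55 / 16 / y ^ 2 := by
      rw [sub_nonneg, div_le_one (by positivity)]
      nlinarith
    positivity
  unfold bW bV
  have h2 := mul_nonneg hsp.le h1
  have h3 : 0 ≤ 33 / 8 * 0.698 / (y ^ 2 * √y) := by positivity
  have h4 : 0 ≤ 2 / (1.69 * √y) := by positivity
  linarith

lemma bW_five : - bW 5 ≤ 0.534 := by
  have h1 := abs_le.mp J1_five
  have h2 := abs_le.mp J2_five
  have hr : √5 < 2.23607 := by
    rw [Real.sqrt_lt' (by norm_num)]; norm_num
  have hr' : 2.23606 < √5 := by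
    rw [Real.lt_sqrt (by norm_num)]; norm_num
  have hJ : J2 5 ^ 2 ≤ 0.046576 ^ 2 := by
    apply sq_le_sq'
    · norm_num at *
      linarith
    · norm_num at *
      linarith
  have hb1 : bP 5 ≤ -0.34153 := by
    unfold bP
    norm_num at *
    linarith
  have hb2 : -0.34157 ≤ bP 5 := by
    unfold bP
    norm_num at *
    linarith
  have hP : bP 5 ^ 2 ≤ 0.34157 ^ 2 := by
    apply sq_le_sq'
    · norm_num at *
      linarith
    · norm_num at *
      linarith
  have hJP : J2 5 * bP 5 ≤ 0.04655 * (-0.34153) := by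
    norm_num at *
    nlinarith
  have hX : bP 5 ^ 2 + J2 5 * bP 5 / (2 * 5) + (1 - 27 / 8 / 5 ^ 2) * J2 5 ^ 2 ≤ 0.11696 := by
    norm_num at *
    linarith
  have hX2 : √5 * (bP 5 ^ 2 + J2 5 * bP 5 / (2 * 5) + (1 - 27 / 8 / 5 ^ 2) * J2 5 ^ 2)
      ≤ 2.23607 * 0.11696 := by
    apply (mul_le_mul_of_nonneg_left hX (Real.sqrt_nonneg 5)).trans
    gcongr
  have h3 : 33 / 8 * 0.698 / (5 ^ 2 * √5) ≤ 33 / 8 * 0.698 / (5 ^ 2 * 2.23606) := by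
    gcongr
  have h4 : 2 / (1.69 * √5) ≤ 2 / (1.69 * 2.23606) := by
    gcongr
  unfold bW bV
  norm_num at *
  linarith

lemma J2_div (y : ℝ) : J2 y / y = y / 4 * bG 2 (y ^ 2 / 4) := by
  rw [J2_eq]
  rcases eq_or_ne y 0 with rfl | h
  · simp
  · field_simp

lemma J2_div_cont : Continuous (fun y : ℝ => J2 y / y) := by
  simp_rw [J2_div]
  have : Continuous (fun y : ℝ => bG 2 (y ^ 2 / 4)) :=
    continuous_iff_continuousAt.mpr fun y => (bGsq_deriv 2 y).continuousAt
  fun_prop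

lemma abs_J2_div_cont : ContinuousOn (fun y : ℝ => |J2 y| / y) (Set.Ici 0) := by
  refine J2_div_cont.abs.continuousOn.congr ?_
  intro y hy
  simp only [abs_div, abs_of_nonneg (Set.mem_Ici.mp hy)]

lemma part_one : ∫ y in (0 : ℝ)..5, |J2 y| / y ≤ 0.56552 := by
  have e : ∫ y in (0 : ℝ)..5, |J2 y| / y = ∫ y in (0 : ℝ)..5, J2 y / y := by
    apply intervalIntegral.integral_congr
    intro y hy
    rw [Set.uIcc_of_le (by norm_num)] at hy
    have : 0 ≤ J2 y := by
      rw [J2_eq]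
      have := bG2_nonneg (y ^ 2 / 4) (by positivity) (by nlinarith [hy.1, hy.2])
      positivity
    simp only [abs_of_nonneg this]
  rw [e, intervalIntegral.integral_eq_sub_of_hasDerivAt
    (f := fun y : ℝ => - (1 / 2 * bG 1 (y ^ 2 / 4)))]
  · have h1 := abs_le.mp J1_five
    have h0 : bG 1 (0 ^ 2 / 4) = 1 := by
      unfold bG
      rw [tsum_eq_single 0]
      · simp [bA]
      · intro b hb
        simp [hb]
    rw [h0]
    unfold J1 at h1
    norm_num at *
    linarith
  · intro y _
    refine ((bGsq_deriv 1 y).const_mul (1 / 2)).neg.congr_deriv ?_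
    rw [J2_div]
    ring
  · exact J2_div_cont.intervalIntegrable _ _

lemma int_two : IntegrableOn (fun y : ℝ => |J2 y| / y) (Set.Ioi 5) := by
  have hd : IntegrableOn (fun y : ℝ => y ^ (-(3 / 2) : ℝ)) (Set.Ioi 5) :=
    integrableOn_Ioi_rpow_of_lt (by norm_num) (by norm_num)
  refine Integrable.mono' hd ?_ ?_
  · exact (abs_J2_div_cont.mono (fun y hy => by
      have : (5 : ℝ) < y := hy
      exact Set.mem_Ici.mpr (by linarith))).aestronglyMeasurable measurableSet_Ioi
  · refine (ae_restrict_iff' measurableSet_Ioi).mpr (Filter.Eventually.of_forall ?_)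
    intro y hy
    have hy5 : (5 : ℝ) < y := hy
    have hy0 : 0 < y := by linarith
    have hb := J2_sq_bound y hy5.le
    have hsp := Real.sqrt_pos.mpr hy0
    rw [Real.norm_eq_abs, abs_of_nonneg (by positivity)]
    have e : y ^ (-(3 / 2) : ℝ) = 1 / (y * √y) := by
      rw [Real.rpow_neg hy0.le, show (3 / 2 : ℝ) = 1 + 1 / 2 by norm_num, Real.rpow_add hy0,
        Real.rpow_one, ← Real.sqrt_eq_rpow, one_div]
    rw [e, div_le_div_iff₀ hy0 (by positivity)]
    have h1 : |J2 y| * √y ≤ 1 := by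
      refine (sq_le_one_iff₀ (by positivity)).mp ?_
      rw [mul_pow, sq_abs, Real.sq_sqrt hy0.le]
      norm_num at hb
      linarith
    nlinarith

lemma part_two : ∫ y in Set.Ioi (5 : ℝ), |J2 y| / y ≤ 0.534 := by
  have ht := intervalIntegral_tendsto_integral_Ioi 5 int_two Filter.tendsto_id
  refine le_of_tendsto ht ?_
  filter_upwards [Filter.eventually_ge_atTop (5 : ℝ)] with B hB
  simp only [id]
  have := intervalIntegral.integral_le_sub_of_hasDeriv_right_of_le (g := bW)
    (φ := fun y : ℝ => |J2 y| / y) hB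
    (fun y hy => (bW_deriv y (by linarith [hy.1])).continuousAt.continuousWithinAt)
    (fun y hy => (bW_deriv y (by linarith [hy.1])).hasDerivWithinAt)
    ((abs_J2_div_cont.mono (fun y hy => by
      exact Set.mem_Ici.mpr (by linarith [hy.1]))).integrableOn_Icc)
    (fun y hy => bW_deriv_ge y hy.1.le)
  linarith [bW_nonpos B hB, bW_five]

theorem stmt_19 :
    IntegrableOn (fun y : ℝ => |J2 y| / y) (Set.Ioi 0) ∧
      ∫ y in Set.Ioi (0 : ℝ), |J2 y| / y ≤ 1.1 := by
  have h1 : IntegrableOn (fun y : ℝ => |J2 y| / y) (Set.Ioc 0 5) :=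
    ((abs_J2_div_cont.mono Set.Icc_subset_Ici_self).integrableOn_Icc).mono_set
      Set.Ioc_subset_Icc_self
  have hu : Set.Ioc (0 : ℝ) 5 ∪ Set.Ioi 5 = Set.Ioi 0 := Set.Ioc_union_Ioi_eq_Ioi (by norm_num)
  refine ⟨hu ▸ h1.union int_two, ?_⟩
  rw [← hu, setIntegral_union (Set.Ioc_disjoint_Ioi le_rfl) measurableSet_Ioi h1 int_two]
  have h3 := part_one
  rw [intervalIntegral.integral_of_le (by norm_num)] at h3
  have h4 := part_two
  norm_num at *
  linarith
end
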